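/- Weitzenböck formula for exterior forms: for every λ ∈ ℝ and every smooth exterior form η : U → Λ, D(Dη) − λ·Δ^{(T)}η = −λ·Σ_{A,B} R_{AB}·C^A(P^B η) + (λ/2)·Σ_{A,B,C,D} R_{AB,CD}·C^B(C^A(P^D(P^C η))), where D η := Σ_A (C^A + λP^A)(∇_A η), Δ^{(T)} η := (1/ρ_g)·Σ_{A,B} ∇_A(ρ_g·g^{AB}·∇_B η), and R_{AB,CD} := Σ_E g_{DE}·R^E{}_{ABC}. -/

import Mathlib

/-- The `A`-th partial derivative of a function `f : ℝⁿ → ℝ`. -/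
noncomputable def pd {n : ℕ} (A : Fin n) (f : (Fin n → ℝ) → ℝ) (z : Fin n → ℝ) : ℝ :=
  fderiv ℝ f z (Pi.single A 1)

/-- Lowered Levi–Civita Christoffel symbols
`Γ_{CAB} := ½(∂_A g_{CB} + ∂_B g_{CA} − ∂_C g_{AB})`. -/
noncomputable def christLow {n : ℕ} (gl : (Fin n → ℝ) → Fin n → Fin n → ℝ)
    (C A B : Fin n) (z : Fin n → ℝ) : ℝ :=
  (pd A (fun u => gl u C B) z + pd B (fun u => gl u C A) z - pd C (fun u => gl u A B) z) / 2

/-- Levi–Civita Christoffel symbols `Γ^A{}_{BC} := Σ_D g^{AD} Γ_{DBC}`. -/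
noncomputable def christ {n : ℕ} (g gl : (Fin n → ℝ) → Fin n → Fin n → ℝ)
    (A B C : Fin n) (z : Fin n → ℝ) : ℝ :=
  ∑ D, g z A D * christLow gl D B C z

/-- Riemann curvature `R^D{}_{ABC}` of the Levi–Civita connection. -/
noncomputable def riem {n : ℕ} (g gl : (Fin n → ℝ) → Fin n → Fin n → ℝ)
    (D A B C : Fin n) (z : Fin n → ℝ) : ℝ :=
  pd A (christ g gl D B C) z - pd B (christ g gl D A C) z
    + ∑ E, (christ g gl D A E z * christ g gl E B C z
            - christ g gl D B E z * christ g gl E A C z)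

/-- Ricci tensor `R_{AB} := Σ_C R^C{}_{CAB}`. -/
noncomputable def ricci {n : ℕ} (g gl : (Fin n → ℝ) → Fin n → Fin n → ℝ)
    (A B : Fin n) (z : Fin n → ℝ) : ℝ :=
  ∑ C, riem g gl C C A B z

/-- `R_{AB,CD} := Σ_E g_{DE}·R^E{}_{ABC}`. -/
noncomputable def riemLow {n : ℕ} (g gl : (Fin n → ℝ) → Fin n → Fin n → ℝ)
    (A B C D : Fin n) (z : Fin n → ℝ) : ℝ :=
  ∑ E, gl z D E * riem g gl E A B C z

/-- Canonical density `ρ_g := √(det(g_{AB}))`. -/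
noncomputable def rhoG {n : ℕ} (gl : (Fin n → ℝ) → Fin n → Fin n → ℝ) (z : Fin n → ℝ) : ℝ :=
  Real.sqrt (Matrix.det (Matrix.of fun A B => gl z A B))

/-- The exterior algebra `Λ` of `ℝⁿ`. -/
abbrev Lam (n : ℕ) : Type := ExteriorAlgebra ℝ (Fin n → ℝ)

/-- `C^A`: left exterior multiplication by the generator `ε^A`. -/
noncomputable def Cop {n : ℕ} (A : Fin n) : Lam n →ₗ[ℝ] Lam n :=
  LinearMap.mulLeft ℝ (ExteriorAlgebra.ι ℝ (Pi.single A 1))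

/-- `ι_A`: the interior product, i.e. the odd derivation of `Λ` with `ι_A ε^B = δ_A^B` and
`ι_A 1 = 0` (realized as contraction with the `A`-th coordinate functional). -/
noncomputable def iop {n : ℕ} (A : Fin n) : Lam n →ₗ[ℝ] Lam n :=
  CliffordAlgebra.contractLeft (Q := (0 : QuadraticForm ℝ (Fin n → ℝ)))
    (LinearMap.proj A)

/-- `P^A := Σ_B g^{AB}·ι_B` (with pointwise scalar coefficients). -/
noncomputable def Pop {n : ℕ} (g : (Fin n → ℝ) → Fin n → Fin n → ℝ) (A : Fin n)
    (z : Fin n → ℝ) : Lam n →ₗ[ℝ] Lam n :=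
  ∑ B, g z A B • iop B

/-- The covariant derivative `∇_A η := ∂_A η − Σ_{B,C} Γ^B{}_{AC}·C^C(ι_B η)` of an exterior
form, expressed through a given family `dη` of partial derivatives. -/
noncomputable def nablaForm {n : ℕ} (g gl : (Fin n → ℝ) → Fin n → Fin n → ℝ)
    (dη : Fin n → (Fin n → ℝ) → Lam n) (η : (Fin n → ℝ) → Lam n)
    (A : Fin n) (z : Fin n → ℝ) : Lam n :=
  dη A z - ∑ B, ∑ C, christ g gl B A C z • Cop C (iop B (η z))

/-- The Dirac operator `Dη := Σ_A (C^A + λP^A)(∇_A η)` on exterior forms. -/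
noncomputable def diracForm {n : ℕ} (g gl : (Fin n → ℝ) → Fin n → Fin n → ℝ) (lam : ℝ)
    (dη : Fin n → (Fin n → ℝ) → Lam n) (η : (Fin n → ℝ) → Lam n)
    (w : Fin n → ℝ) : Lam n :=
  ∑ A, (Cop A (nablaForm g gl dη η A w) + lam • Pop g A w (nablaForm g gl dη η A w))

/-- The inner function `ρ_g·g^{AB}·∇_B η` appearing in the Laplacian `Δ^{(T)}`. -/
noncomputable def innerLap {n : ℕ} (g gl : (Fin n → ℝ) → Fin n → Fin n → ℝ)
    (dη : Fin n → (Fin n → ℝ) → Lam n) (η : (Fin n → ℝ) → Lam n)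
    (A B : Fin n) (w : Fin n → ℝ) : Lam n :=
  (rhoG gl w * g w A B) • nablaForm g gl dη η B w

open scoped Topology

section PartialDerivative

variable {n : ℕ} {A : Fin n} {f h : (Fin n → ℝ) → ℝ} {z : Fin n → ℝ}

theorem pd_congr (hfh : f =ᶠ[𝓝 z] h) : pd A f z = pd A h z := by
  unfold pd; rw [hfh.fderiv_eq]

theorem pd_const (c : ℝ) : pd A (fun _ => c) z = 0 := by
  simp [pd]

theorem pd_add (hf : DifferentiableAt ℝ f z) (hh : DifferentiableAt ℝ h z) :
    pd A (fun w => f w + h w) z = pd A f z + pd A h z := by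
  simp [pd, fderiv_fun_add hf hh]

theorem pd_neg : pd A (fun w => -f w) z = -pd A f z := by
  simp [pd]

theorem pd_sub (hf : DifferentiableAt ℝ f z) (hh : DifferentiableAt ℝ h z) :
    pd A (fun w => f w - h w) z = pd A f z - pd A h z := by
  simp [pd, fderiv_fun_sub hf hh]

theorem pd_mul (hf : DifferentiableAt ℝ f z) (hh : DifferentiableAt ℝ h z) :
    pd A (fun w => f w * h w) z = pd A f z * h z + f z * pd A h z := by
  simp only [pd, fderiv_fun_mul hf hh, FunLike.coe_add, FunLike.coe_smul, Pi.add_apply,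
    Pi.smul_apply, smul_eq_mul]
  ring

theorem pd_sum {ι : Type*} {s : Finset ι} {F : ι → (Fin n → ℝ) → ℝ}
    (hF : ∀ i ∈ s, DifferentiableAt ℝ (F i) z) :
    pd A (fun w => ∑ i ∈ s, F i w) z = ∑ i ∈ s, pd A (F i) z := by
  simp only [pd, fderiv_fun_sum hF, FunLike.coe_sum, Finset.sum_apply]

theorem pd_sum_mul {ι : Type*} [Fintype ι] {F K : ι → (Fin n → ℝ) → ℝ}
    (hF : ∀ i, DifferentiableAt ℝ (F i) z) (hK : ∀ i, DifferentiableAt ℝ (K i) z) :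
    pd A (fun w => ∑ i, F i w * K i w) z =
      ∑ i, pd A (F i) z * K i z + ∑ i, F i z * pd A (K i) z := by
  rw [pd_sum fun i _ => (hF i).fun_mul (hK i), ← Finset.sum_add_distrib]
  exact Finset.sum_congr rfl fun i _ => pd_mul (hF i) (hK i)

theorem ContDiffOn.pd {U : Set (Fin n → ℝ)} (hU : IsOpen U) (A : Fin n)
    (hf : ContDiffOn ℝ (⊤ : ℕ∞) f U) : ContDiffOn ℝ (⊤ : ℕ∞) (pd A f) U :=
  (hf.fderiv_of_isOpen hU (by simp)).clm_apply contDiffOn_const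

theorem ContDiffOn.differentiableAt_of_isOpen {U : Set (Fin n → ℝ)} (hU : IsOpen U)
    (hf : ContDiffOn ℝ (⊤ : ℕ∞) f U) (hz : z ∈ U) : DifferentiableAt ℝ f z :=
  (hf.contDiffAt (hU.mem_nhds hz)).differentiableAt (by simp)

theorem pd_comm {U : Set (Fin n → ℝ)} (hU : IsOpen U) (hf : ContDiffOn ℝ (⊤ : ℕ∞) f U)
    (hz : z ∈ U) (A B : Fin n) : pd A (pd B f) z = pd B (pd A f) z := by
  have hf' : DifferentiableAt ℝ (fderiv ℝ f) z :=
    ((hf.fderiv_of_isOpen (m := (⊤ : ℕ∞)) hU (by simp)).contDiffAt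
      (hU.mem_nhds hz)).differentiableAt (by simp)
  have key (X Y : Fin n) : pd X (pd Y f) z =
      fderiv ℝ (fderiv ℝ f) z (Pi.single X 1) (Pi.single Y 1) := by
    change fderiv ℝ (fun w => fderiv ℝ f w (Pi.single Y 1)) z (Pi.single X 1) = _
    rw [fderiv_clm_apply hf' (differentiableAt_const _)]
    simp
  rw [key, key]
  refine ((hf.contDiffAt (hU.mem_nhds hz)).isSymmSndFDerivAt ?_).eq _ _
  rw [minSmoothness_of_isRCLikeNormedField]
  exact WithTop.coe_le_coe.2 (le_top : (2 : ℕ∞) ≤ ⊤)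

end PartialDerivative

section Determinant

open Matrix

variable {n : ℕ} {U : Set (Fin n → ℝ)} {M : (Fin n → ℝ) → Matrix (Fin n) (Fin n) ℝ}

theorem contDiffOn_matrix_det (hM : ∀ A B, ContDiffOn ℝ (⊤ : ℕ∞) (fun z => M z A B) U) :
    ContDiffOn ℝ (⊤ : ℕ∞) (fun z => (M z).det) U := by
  simp only [Matrix.det_apply]
  exact ContDiffOn.sum fun σ _ => (contDiffOn_prod fun i _ => hM _ _).const_smul _

theorem contDiffOn_matrix_adjugate (hM : ∀ A B, ContDiffOn ℝ (⊤ : ℕ∞) (fun z => M z A B) U)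
    (A B : Fin n) : ContDiffOn ℝ (⊤ : ℕ∞) (fun z => (M z).adjugate A B) U := by
  simp only [Matrix.adjugate_apply]
  refine contDiffOn_matrix_det fun i j => ?_
  by_cases hi : i = B
  · simpa [Matrix.updateRow_apply, hi] using contDiffOn_const
  · simpa [Matrix.updateRow_apply, hi] using hM i j

/-- Jacobi's formula. -/
theorem pd_det {z : Fin n → ℝ} (hM : ∀ B C, DifferentiableAt ℝ (fun w => M w B C) z)
    (A : Fin n) :
    DifferentiableAt ℝ (fun w => (M w).det) z ∧
    pd A (fun w => (M w).det) z =
      ∑ B, ∑ C, (M z).adjugate C B * pd A (fun w => M w B C) z := by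
  let D : ContinuousMultilinearMap ℝ (fun _ : Fin n => Fin n → ℝ) ℝ :=
    ⟨(Matrix.detRowAlternating (R := ℝ) (n := Fin n)).toMultilinearMap, by
      exact Continuous.matrix_det continuous_id⟩
  have hrow : ∀ B, HasFDerivAt (fun w => M w B)
      (ContinuousLinearMap.pi fun C => fderiv ℝ (fun w => M w B C) z) z := fun B =>
    hasFDerivAt_pi.2 fun C => (hM B C).hasFDerivAt
  have hD := (D.hasFDerivAt (x := fun B => M z B)).comp z (hasFDerivAt_pi.2 hrow)
  have hDM : HasFDerivAt (fun w => (M w).det) _ z := hD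
  refine ⟨hDM.differentiableAt, ?_⟩
  unfold pd
  rw [hDM.fderiv]
  simp only [ContinuousLinearMap.comp_apply, ContinuousMultilinearMap.linearDeriv_apply]
  refine Finset.sum_congr rfl fun B _ => ?_
  change Matrix.det (Matrix.updateRow (M z) B _) = _
  rw [← Matrix.cramer_transpose_apply, Matrix.cramer_eq_adjugate_mulVec,
    ← Matrix.adjugate_transpose]
  simp [Matrix.mulVec, dotProduct]

end Determinant

section LeviCivita

open Matrix

variable {n : ℕ} {U : Set (Fin n → ℝ)} {g gl : (Fin n → ℝ) → Fin n → Fin n → ℝ}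
  {z : Fin n → ℝ}

/-- `g` is a smooth contravariant metric on the open set `U`, with positive definite inverse
`gl`. -/
structure IsMetricOn (U : Set (Fin n → ℝ)) (g gl : (Fin n → ℝ) → Fin n → Fin n → ℝ) : Prop where
  isOpen : IsOpen U
  smooth : ∀ A B, ContDiffOn ℝ (⊤ : ℕ∞) (fun z => g z A B) U
  symm : ∀ z ∈ U, ∀ A B, g z A B = g z B A
  inv : ∀ z ∈ U, ∀ A C, ∑ B, gl z A B * g z B C = if A = C then 1 else 0
  posDef : ∀ z ∈ U, (Matrix.of fun A B => gl z A B).PosDef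

/-- The matrix of the endomorphism `Γ_A`, with entries `Γ^D{}_{AC}`. -/
noncomputable def christMatrix (g gl : (Fin n → ℝ) → Fin n → Fin n → ℝ) (A : Fin n)
    (z : Fin n → ℝ) : Matrix (Fin n) (Fin n) ℝ :=
  Matrix.of fun D C => christ g gl D A C z

/-- The matrix of the curvature endomorphism `R_{AB}`, with entries `R^D{}_{ABC}`. -/
noncomputable def riemMatrix (g gl : (Fin n → ℝ) → Fin n → Fin n → ℝ) (A B : Fin n)
    (z : Fin n → ℝ) : Matrix (Fin n) (Fin n) ℝ :=
  Matrix.of fun D C => riem g gl D A B C z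

theorem christMatrix_eq (A : Fin n) : christMatrix g gl A z =
    Matrix.of (g z) * Matrix.of fun D C => christLow gl D A C z := by
  ext D C
  simp [christMatrix, christ, Matrix.mul_apply]

theorem riemMatrix_eq (A B : Fin n) : riemMatrix g gl A B z =
    (Matrix.of fun D C => pd A (christ g gl D B C) z) -
      (Matrix.of fun D C => pd B (christ g gl D A C) z) +
      (christMatrix g gl A z * christMatrix g gl B z -
        christMatrix g gl B z * christMatrix g gl A z) := by
  ext D C
  simp [riemMatrix, riem, christMatrix, Matrix.mul_apply]

theorem riem_antisymm (A B C D : Fin n) : riem g gl D A B C z = -riem g gl D B A C z := by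
  simp only [riem, Finset.sum_sub_distrib]
  ring

theorem riemLow_antisymm (A B C D : Fin n) :
    riemLow g gl A B C D z = -riemLow g gl B A C D z := by
  simp only [riemLow, ← Finset.sum_neg_distrib]
  exact Finset.sum_congr rfl fun E _ => by rw [riem_antisymm]; ring

namespace IsMetricOn

variable (H : IsMetricOn U g gl) (hz : z ∈ U)
include H

theorem eventually {p : (Fin n → ℝ) → Prop} (hz : z ∈ U) (hp : ∀ w ∈ U, p w) :
    ∀ᶠ w in 𝓝 z, p w :=
  Filter.mem_of_superset (H.isOpen.mem_nhds hz) hp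

include hz in
theorem gl_mul_g : Matrix.of (gl z) * Matrix.of (g z) = 1 := by
  ext A C
  simpa [Matrix.mul_apply, Matrix.one_apply] using H.inv z hz A C

include hz in
theorem g_mul_gl : Matrix.of (g z) * Matrix.of (gl z) = 1 :=
  mul_eq_one_comm.1 (H.gl_mul_g hz)

include hz in
theorem sum_g_gl (A C : Fin n) : ∑ B, g z A B * gl z B C = if A = C then 1 else 0 := by
  simpa [Matrix.mul_apply, Matrix.one_apply] using congr_fun₂ (H.g_mul_gl hz) A C

include hz in
theorem gl_symm (A B : Fin n) : gl z A B = gl z B A := by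
  simpa using (H.posDef z hz).1.apply B A

theorem smooth_gl (A B : Fin n) : ContDiffOn ℝ (⊤ : ℕ∞) (fun z => gl z A B) U := by
  have hdet : ∀ z ∈ U, (Matrix.of (g z)).det ≠ 0 := fun z hz h => by
    simpa [h] using congr_arg Matrix.det (H.g_mul_gl hz)
  have hM : ∀ A B, ContDiffOn ℝ (⊤ : ℕ∞) (fun z => Matrix.of (g z) A B) U := H.smooth
  refine (((contDiffOn_matrix_det hM).inv hdet).mul
    (contDiffOn_matrix_adjugate hM A B)).congr fun w hw => ?_
  have h : Matrix.of (gl w) = ((Matrix.of (g w)).det)⁻¹ • (Matrix.of (g w)).adjugate := by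
    have h1 := congr_arg (Matrix.of (gl w) * ·) (Matrix.mul_adjugate (Matrix.of (g w)))
    simp only [← mul_assoc, H.gl_mul_g hw, one_mul, Matrix.mul_smul, mul_one] at h1
    rw [h1, smul_smul, inv_mul_cancel₀ (hdet w hw), one_smul]
  simpa using congr_fun₂ h A B

include hz in
theorem differentiableAt_g (A B : Fin n) : DifferentiableAt ℝ (fun w => g w A B) z :=
  (H.smooth A B).differentiableAt_of_isOpen H.isOpen hz

include hz in
theorem differentiableAt_gl (A B : Fin n) : DifferentiableAt ℝ (fun w => gl w A B) z :=
  (H.smooth_gl A B).differentiableAt_of_isOpen H.isOpen hz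

theorem smooth_christ (A B C : Fin n) : ContDiffOn ℝ (⊤ : ℕ∞) (christ g gl A B C) U := by
  have hX (A B C : Fin n) : ContDiffOn ℝ (⊤ : ℕ∞) (christLow gl A B C) U :=
    ((((H.smooth_gl _ _).pd H.isOpen _).add ((H.smooth_gl _ _).pd H.isOpen _)).sub
      ((H.smooth_gl _ _).pd H.isOpen _)).div_const 2
  exact ContDiffOn.sum fun D _ => (H.smooth A D).mul (hX D B C)

include hz in
theorem differentiableAt_christ (A B C : Fin n) : DifferentiableAt ℝ (christ g gl A B C) z :=
  (H.smooth_christ A B C).differentiableAt_of_isOpen H.isOpen hz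

include hz in
theorem pd_gl_symm (A B C : Fin n) :
    pd A (fun w => gl w B C) z = pd A (fun w => gl w C B) z :=
  pd_congr (H.eventually hz fun _ hw => H.gl_symm hw B C)

include hz in
theorem christ_symm (A B C : Fin n) : christ g gl A B C z = christ g gl A C B z := by
  simp only [christ, christLow, H.pd_gl_symm hz _ B C, add_comm (pd B _ z)]

include hz in
theorem pd_gl (A B C : Fin n) :
    pd A (fun w => gl w B C) z = christLow gl B A C z + christLow gl C A B z := by
  simp only [christLow, H.pd_gl_symm hz A C B, H.pd_gl_symm hz C A B, H.pd_gl_symm hz B A C]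
  ring

include hz in
/-- Metric compatibility of the Levi–Civita connection. -/
theorem pd_g_matrix (A : Fin n) :
    (Matrix.of fun B C => pd A (fun w => g w B C) z) =
      -(christMatrix g gl A z * Matrix.of (g z)) - Matrix.of (g z) * (christMatrix g gl A z)ᵀ := by
  set dG : Matrix (Fin n) (Fin n) ℝ := Matrix.of fun B C => pd A (fun w => g w B C) z
  set dL : Matrix (Fin n) (Fin n) ℝ := Matrix.of fun B C => pd A (fun w => gl w B C) z with hdL
  set G : Matrix (Fin n) (Fin n) ℝ := Matrix.of (g z) with hG
  set L : Matrix (Fin n) (Fin n) ℝ := Matrix.of (gl z)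
  have hGt : Gᵀ = G := by ext B C; exact H.symm z hz C B
  have h1 : dL * G + L * dG = 0 := by
    ext B D
    have h := pd_congr (A := A) (H.eventually hz fun w hw => H.inv w hw B D)
    rw [pd_const, pd_sum_mul (H.differentiableAt_gl hz B) (H.differentiableAt_g hz · D)] at h
    rw [Matrix.add_apply, Matrix.mul_apply, Matrix.mul_apply]
    exact h
  have h2 : dL = (Matrix.of fun D C => christLow gl D A C z) +
      (Matrix.of fun D C => christLow gl D A C z)ᵀ := by
    ext B C
    simp [hdL, H.pd_gl hz]
  have h3 : dG = -(G * (dL * G)) := by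
    rw [eq_neg_of_add_eq_zero_left h1, mul_neg, neg_neg, ← mul_assoc, H.g_mul_gl hz, one_mul]
  rw [h3, h2, christMatrix_eq, Matrix.transpose_mul, hGt]
  noncomm_ring

include hz in
theorem pd_g (A B D : Fin n) : pd A (fun w => g w B D) z =
    -(∑ C, christ g gl B A C z * g z C D) - ∑ C, g z B C * christ g gl D A C z := by
  simpa [Matrix.mul_apply, christMatrix] using congr_fun₂ (H.pd_g_matrix hz A) B D

include hz in
/-- The logarithmic derivative of the canonical density is the trace of the connection. -/
theorem pd_rhoG (A : Fin n) : DifferentiableAt ℝ (rhoG gl) z ∧ 0 < rhoG gl z ∧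
    pd A (rhoG gl) z = rhoG gl z * ∑ C, christ g gl C A C z := by
  obtain ⟨hd, hpd⟩ := pd_det (M := fun w => Matrix.of fun A B => gl w A B)
    (fun B C => H.differentiableAt_gl hz B C) A
  have hpos := (H.posDef z hz).det_pos
  have hf := hd.hasFDerivAt.sqrt hpos.ne'
  have hrho : HasFDerivAt (rhoG gl) _ z := hf
  have hadj : (Matrix.of fun A B => gl z A B).adjugate =
      (Matrix.of fun A B => gl z A B).det • Matrix.of (g z) := by
    have h1 := congr_arg (· * Matrix.of (g z)) (Matrix.adjugate_mul (Matrix.of (gl z)))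
    simpa [mul_assoc, H.gl_mul_g hz] using h1
  refine ⟨hrho.differentiableAt, Real.sqrt_pos.2 hpos, ?_⟩
  have htr : pd A (fun w => (Matrix.of fun A B => gl w A B).det) z =
      2 * (Matrix.of fun A B => gl z A B).det * ∑ C, christ g gl C A C z := by
    have h1 : ∑ B, ∑ C, g z C B * christLow gl B A C z = ∑ C, christ g gl C A C z :=
      Finset.sum_comm
    have h2 : ∑ B, ∑ C, g z C B * christLow gl C A B z = ∑ C, christ g gl C A C z :=
      Finset.sum_congr rfl fun B _ => Finset.sum_congr rfl fun C _ => by rw [H.symm z hz C B]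
    rw [hpd, hadj, mul_comm 2, mul_assoc, two_mul]
    nth_rewrite 1 [← h1]
    rw [← h2]
    simp only [Matrix.of_apply, H.pd_gl hz, Matrix.smul_apply, smul_eq_mul, mul_add,
      Finset.sum_add_distrib, Finset.mul_sum, mul_assoc]
  have h : pd A (rhoG gl) z = (1 / (2 * rhoG gl z)) *
      pd A (fun w => (Matrix.of fun A B => gl w A B).det) z := by
    unfold pd
    rw [hrho.fderiv]
    rfl
  have hsq : rhoG gl z * rhoG gl z = (Matrix.of fun A B => gl z A B).det :=
    Real.mul_self_sqrt hpos.le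
  have hr : rhoG gl z ≠ 0 := (Real.sqrt_pos.2 hpos).ne'
  rw [h, htr, ← hsq]
  field_simp

include hz in
/-- First Bianchi identity. -/
theorem riem_bianchi (A B C D : Fin n) :
    riem g gl D A B C z + riem g gl D B C A z + riem g gl D C A B z = 0 := by
  have hs (X Y Z : Fin n) : pd X (christ g gl D Y Z) z = pd X (christ g gl D Z Y) z :=
    pd_congr (H.eventually hz fun _ hw => H.christ_symm hw D Y Z)
  simp only [riem, Finset.sum_sub_distrib, hs _ B A, hs _ C A, hs _ C B,
    H.christ_symm hz _ B A, H.christ_symm hz _ C A, H.christ_symm hz _ C B]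
  ring

include hz in
/-- The curvature endomorphisms are skew with respect to the metric. -/
theorem riemMatrix_skew (A B : Fin n) :
    riemMatrix g gl A B z * Matrix.of (g z) + Matrix.of (g z) * (riemMatrix g gl A B z)ᵀ = 0 := by
  have hGt : (Matrix.of (g z))ᵀ = Matrix.of (g z) := by ext B C; exact H.symm z hz C B
  have key (X Y : Fin n) : (Matrix.of fun B C => pd X (pd Y fun w => g w B C) z) =
      -((Matrix.of fun D C => pd X (christ g gl D Y C) z) * Matrix.of (g z)
        + christMatrix g gl Y z * (Matrix.of fun B C => pd X (fun w => g w B C) z))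
      - ((Matrix.of fun B C => pd X (fun w => g w B C) z) * (christMatrix g gl Y z)ᵀ +
        Matrix.of (g z) * (Matrix.of fun D C => pd X (christ g gl D Y C) z)ᵀ) := by
    ext B D
    have h := pd_congr (A := X) (H.eventually hz fun w hw => H.pd_g hw Y B D)
    rw [pd_sub (DifferentiableAt.fun_sum fun C _ =>
        (H.differentiableAt_christ hz B Y C).fun_mul (H.differentiableAt_g hz C D)).fun_neg
        (DifferentiableAt.fun_sum fun C _ =>
          (H.differentiableAt_g hz B C).fun_mul (H.differentiableAt_christ hz D Y C)), pd_neg,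
      pd_sum_mul (H.differentiableAt_christ hz B Y) (H.differentiableAt_g hz · D),
      pd_sum_mul (H.differentiableAt_g hz B) (H.differentiableAt_christ hz D Y)] at h
    simpa [Matrix.mul_apply, christMatrix] using h
  have hcomm : (Matrix.of fun C D => pd A (pd B fun w => g w C D) z) =
      Matrix.of fun C D => pd B (pd A fun w => g w C D) z := by
    ext C D
    exact pd_comm H.isOpen (H.smooth C D) hz A B
  rw [key, key, H.pd_g_matrix hz, H.pd_g_matrix hz] at hcomm
  rw [riemMatrix_eq]
  simp only [Matrix.transpose_add, Matrix.transpose_sub, Matrix.transpose_mul]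
  rw [← sub_eq_zero] at hcomm
  rw [← neg_eq_zero, ← hcomm]
  noncomm_ring

include hz in
theorem riemLow_skew (A B C D : Fin n) :
    riemLow g gl A B C D z = -riemLow g gl A B D C z := by
  have h := congr_arg (Matrix.of (gl z) * · * Matrix.of (gl z)) (H.riemMatrix_skew hz A B)
  have h' : Matrix.of (gl z) * riemMatrix g gl A B z +
      (riemMatrix g gl A B z)ᵀ * Matrix.of (gl z) = 0 := by
    calc _ = Matrix.of (gl z) * riemMatrix g gl A B z * (Matrix.of (g z) * Matrix.of (gl z)) +
          (Matrix.of (gl z) * Matrix.of (g z)) * (riemMatrix g gl A B z)ᵀ *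
            Matrix.of (gl z) := by
          rw [H.g_mul_gl hz, H.gl_mul_g hz, mul_one, one_mul]
      _ = _ := by
          rw [← mul_zero (Matrix.of (gl z)), ← zero_mul (Matrix.of (gl z)),
            ← H.riemMatrix_skew hz A B]
          noncomm_ring
  have h2 := congr_fun₂ h' D C
  simp only [Matrix.add_apply, Matrix.mul_apply, Matrix.of_apply, riemMatrix,
    Matrix.transpose_apply, Matrix.zero_apply] at h2
  simp only [riemLow]
  rw [eq_neg_iff_add_eq_zero, ← h2]
  congr 1
  exact Finset.sum_congr rfl fun E _ => by rw [H.gl_symm hz C E, mul_comm]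

include hz in
theorem riemLow_bianchi (A B C D : Fin n) :
    riemLow g gl A B C D z + riemLow g gl B C A D z + riemLow g gl C A B D z = 0 := by
  simp only [riemLow, ← Finset.sum_add_distrib, ← mul_add, H.riem_bianchi hz, mul_zero,
    Finset.sum_const_zero]

include hz in
theorem riem_eq_sum_riemLow (A B C D : Fin n) :
    riem g gl D A B C z = ∑ E, g z D E * riemLow g gl A B C E z := by
  simp only [riemLow, Finset.mul_sum, ← mul_assoc]
  rw [Finset.sum_comm]
  simp only [← Finset.sum_mul, H.sum_g_gl hz, ite_mul, one_mul, zero_mul, Finset.sum_ite_eq,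
    Finset.mem_univ, if_true]

end IsMetricOn

end LeviCivita

section CurvatureIdentity

theorem curvature_pair_symm {ι : Type*} {r : ι → ι → ι → ι → ℝ}
    (h1 : ∀ A B C D, r A B C D = -r B A C D) (h2 : ∀ A B C D, r A B C D = -r A B D C)
    (h3 : ∀ A B C D, r A B C D + r B C A D + r C A B D = 0) (A B C D : ι) :
    r A B C D = r C D A B := by
  linarith [h3 A B C D, h3 B C D A, h3 C D A B, h3 D A B C, h1 A B C D, h1 A C B D, h1 A D B C,
    h1 B C A D, h1 B D A C, h1 C D A B, h2 A B C D, h2 A C B D, h2 A D B C, h2 B C A D,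
    h2 B D A C, h2 C D A B, h1 C A B D, h1 B A C D, h1 D B C A, h2 D B C A, h1 D A B C,
    h2 C A B D, h1 C A D B, h2 C A D B, h1 B D C A, h2 A C D B, h1 A C D B, h2 D A B C]

variable {ι E : Type*} [Fintype ι]

theorem sum_rotate [AddCommMonoid E] (f : ι → ι → ι → E) :
    ∑ A, ∑ B, ∑ C, f A B C = ∑ A, ∑ B, ∑ C, f B C A := by
  rw [Finset.sum_comm_cycle]

theorem sum_swap_outer [AddCommMonoid E] (f : ι → ι → ι → E) :
    ∑ A, ∑ B, ∑ C, f A B C = ∑ A, ∑ B, ∑ C, f C B A := by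
  rw [sum_rotate]
  exact Finset.sum_congr rfl fun A _ => Finset.sum_comm

theorem sum_last_first [AddCommMonoid E] (f : ι → ι → ι → ι → E) :
    ∑ A, ∑ B, ∑ C, ∑ D, f A B C D = ∑ D, ∑ A, ∑ B, ∑ C, f A B C D := by
  symm
  rw [Finset.sum_comm]
  refine Finset.sum_congr rfl fun A _ => ?_
  rw [Finset.sum_comm]
  exact Finset.sum_congr rfl fun B _ => Finset.sum_comm

variable [Ring E] [Algebra ℝ E] {x : ι → E}

theorem sum_symm_smul_mul_eq_zero (hx : ∀ A B, x A * x B = -(x B * x A)) {f : ι → ι → ℝ}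
    (hf : ∀ A B, f A B = f B A) : ∑ A, ∑ B, f A B • (x A * x B) = 0 := by
  have h : ∑ A, ∑ B, f A B • (x A * x B) = -∑ A, ∑ B, f A B • (x A * x B) := by
    conv_lhs => rw [Finset.sum_comm]
    simp only [← Finset.sum_neg_distrib, ← smul_neg, ← hx]
    exact Finset.sum_congr rfl fun A _ => Finset.sum_congr rfl fun B _ => by rw [hf]
  have h2 : (2 : ℝ) • ∑ A, ∑ B, f A B • (x A * x B) = 0 := by
    rw [two_smul]; nth_rewrite 1 [h]; exact neg_add_cancel _
  exact (smul_eq_zero.1 h2).resolve_left two_ne_zero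

theorem sum_cyclic_smul_mul_eq_zero (hx : ∀ A B, x A * x B = -(x B * x A))
    {f : ι → ι → ι → ℝ} (hf : ∀ A B C, f A B C + f B C A + f C A B = 0) :
    ∑ A, ∑ B, ∑ C, f A B C • (x A * x B * x C) = 0 := by
  have hcyc (A B C : ι) : x B * x C * x A = x A * x B * x C := by
    rw [mul_assoc, hx C A, mul_neg, ← mul_assoc, hx B A, neg_mul, neg_neg]
  have h1 := sum_rotate fun A B C => f A B C • (x A * x B * x C)
  have h2 := sum_rotate fun A B C => f B C A • (x B * x C * x A)
  have h3 : (3 : ℝ) • ∑ A, ∑ B, ∑ C, f A B C • (x A * x B * x C) = 0 := by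
    calc _ = ∑ A, ∑ B, ∑ C, f A B C • (x A * x B * x C) +
          ∑ A, ∑ B, ∑ C, f B C A • (x B * x C * x A) +
          ∑ A, ∑ B, ∑ C, f C A B • (x C * x A * x B) := by
          rw [← h2, ← h1]; module
      _ = 0 := by
          simp only [← Finset.sum_add_distrib]
          refine Finset.sum_eq_zero fun A _ => Finset.sum_eq_zero fun B _ =>
            Finset.sum_eq_zero fun C _ => ?_
          rw [hcyc A B C, ← hcyc C A B, ← add_smul, ← add_smul, hf,
            zero_smul]
  exact (smul_eq_zero.1 h3).resolve_left three_ne_zero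

/-- The algebraic core of the Weitzenböck formula: the contraction of a curvature tensor with
four Clifford generators, in terms of creation operators `c` and annihilation operators `p`. -/
theorem clifford_curvature_identity {c p : ι → E} {γ : ι → ι → ℝ} {r : ι → ι → ι → ι → ℝ}
    (hc : ∀ A B, c A * c B = -(c B * c A)) (hp : ∀ A B, p A * p B = -(p B * p A))
    (hpc : ∀ A B, p A * c B = γ A B • 1 - c B * p A) (hγ : ∀ A B, γ A B = γ B A)
    (h1 : ∀ A B C D, r A B C D = -r B A C D) (h2 : ∀ A B C D, r A B C D = -r A B D C)
    (h3 : ∀ A B C D, r A B C D + r B C A D + r C A B D = 0) (lam : ℝ) :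
    ∑ A, ∑ B, (c A + lam • p A) * (c B + lam • p B) * ∑ C, ∑ D, r A B C D • (c C * p D) =
      (2 * lam) • (∑ A, ∑ B, (∑ C, ∑ D, γ C D * r C A B D) • (c A * p B)) -
        lam • ∑ A, ∑ B, ∑ C, ∑ D, r A B C D • (c B * c A * (p D * p C)) := by
  have hpair := curvature_pair_symm h1 h2 h3
  set Ric : ι → ι → ℝ := fun A B => ∑ C, ∑ D, γ C D * r C A B D with hRic
  have hRic_symm (A B : ι) : Ric A B = Ric B A := by
    simp only [hRic]
    rw [Finset.sum_comm]
    exact Finset.sum_congr rfl fun C _ => Finset.sum_congr rfl fun D _ => by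
      rw [hγ, hpair D A B C, h1, h2, neg_neg]
  have hRic' (A D : ι) : ∑ B, ∑ C, r A B C D * γ B C = Ric A D :=
    Finset.sum_congr rfl fun B _ => Finset.sum_congr rfl fun C _ => by
      rw [h1, h2, neg_neg, mul_comm]
  have hcontr (q : ι → ι → E) : ∑ A, ∑ B, ∑ C, ∑ D, r A B C D • γ B C • q A D =
      ∑ A, ∑ D, Ric A D • q A D := by
    refine Finset.sum_congr rfl fun A _ => ?_
    rw [sum_rotate]
    refine Finset.sum_congr rfl fun D _ => ?_
    simp only [← hRic', Finset.sum_smul, smul_smul]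
  have hccc : ∑ A, ∑ B, ∑ C, ∑ D, r A B C D • (c A * c B * (c C * p D)) = 0 := by
    rw [sum_last_first]
    refine Finset.sum_eq_zero fun D _ => ?_
    have h := congr_arg (· * p D) (sum_cyclic_smul_mul_eq_zero hc fun A B C => h3 A B C D)
    simpa only [Finset.sum_mul, zero_mul, smul_mul_assoc, mul_assoc] using h
  have hppp : ∑ A, ∑ B, ∑ C, ∑ D, r A B C D • (p A * p B * (c C * p D)) = 0 := by
    have hRicp := sum_symm_smul_mul_eq_zero hp hRic_symm
    have hc1 := (hcontr fun A D => p A * p D).trans hRicp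
    have hc2 : ∑ A, ∑ B, ∑ C, ∑ D, r A B C D • γ A C • (p B * p D) = 0 := by
      rw [Finset.sum_comm, ← neg_eq_zero]
      simp only [← Finset.sum_neg_distrib, ← neg_smul, ← h1]
      exact hc1
    have hc3 : ∑ A, ∑ B, ∑ C, ∑ D, r A B C D • (c C * (p A * p B * p D)) = 0 := by
      have hreorder (A B : ι) : ∑ C, ∑ D, r A B C D • (c C * (p A * p B * p D)) =
        ∑ D, ∑ C, r A B C D • (c C * (p A * p B * p D)) := Finset.sum_comm
      simp only [hreorder]
      rw [sum_last_first]
      refine Finset.sum_eq_zero fun C _ => ?_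
      have hcyc : ∀ A B D, r A B C D + r B D C A + r D A C B = 0 := fun A B D => by
        linarith [h3 A B D C, h2 A B C D, h2 B D C A, h2 D A C B]
      have h := congr_arg (c C * ·) (sum_cyclic_smul_mul_eq_zero hp hcyc)
      simpa only [Finset.mul_sum, mul_zero, mul_smul_comm] using h
    have hterm (A B C D : ι) : p A * p B * (c C * p D) =
        γ B C • (p A * p D) - γ A C • (p B * p D) + c C * (p A * p B * p D) := by
      calc _ = p A * (p B * c C) * p D := by noncomm_ring
        _ = γ B C • (p A * p D) - p A * c C * (p B * p D) := by
          rw [hpc, mul_sub, sub_mul, mul_smul_comm, mul_one, smul_mul_assoc]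
          noncomm_ring
        _ = γ B C • (p A * p D) - γ A C • (p B * p D) + c C * (p A * p B * p D) := by
          rw [hpc, sub_mul, smul_mul_assoc, one_mul]
          noncomm_ring
    simp only [hterm, smul_add, smul_sub, Finset.sum_add_distrib, Finset.sum_sub_distrib]
    rw [hc1, hc2, hc3, sub_zero, add_zero]
  have hpc_cp : ∑ A, ∑ B, ∑ C, ∑ D, r A B C D • (p A * c B * (c C * p D)) =
      ∑ A, ∑ B, ∑ C, ∑ D, r A B C D • (c A * p B * (c C * p D)) := by
    have hZ : ∑ A, ∑ B, ∑ C, ∑ D, r A B C D • γ A B • (c C * p D) = 0 := by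
      have hneg : ∑ A, ∑ B, ∑ C, ∑ D, r A B C D • γ A B • (c C * p D) =
          -∑ A, ∑ B, ∑ C, ∑ D, r A B C D • γ A B • (c C * p D) := by
        conv_lhs => rw [Finset.sum_comm]
        simp only [← Finset.sum_neg_distrib, ← neg_smul, ← h1]
        exact Finset.sum_congr rfl fun A _ => Finset.sum_congr rfl fun B _ => by rw [hγ]
      have h2Z : (2 : ℝ) • ∑ A, ∑ B, ∑ C, ∑ D, r A B C D • γ A B • (c C * p D) = 0 := by
        rw [two_smul]; nth_rewrite 1 [hneg]; exact neg_add_cancel _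
      exact (smul_eq_zero.1 h2Z).resolve_left two_ne_zero
    simp only [hpc, sub_mul, smul_sub, Finset.sum_sub_distrib, smul_mul_assoc, one_mul]
    rw [hZ, zero_sub, Finset.sum_comm]
    simp only [← Finset.sum_neg_distrib, ← neg_smul, ← h1]
  have hcp : ∑ A, ∑ B, ∑ C, ∑ D, r A B C D • (c A * p B * (c C * p D)) =
      ∑ A, ∑ B, Ric A B • (c A * p B) -
        ∑ A, ∑ B, ∑ C, ∑ D, r A B C D • (c A * c C * (p B * p D)) := by
    rw [← hcontr fun A D => c A * p D]
    simp only [← Finset.sum_sub_distrib, ← smul_sub]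
    refine Finset.sum_congr rfl fun A _ => Finset.sum_congr rfl fun B _ =>
      Finset.sum_congr rfl fun C _ => Finset.sum_congr rfl fun D _ => ?_
    congr 1
    calc _ = c A * (p B * c C) * p D := by noncomm_ring
      _ = _ := by
        rw [hpc, mul_sub, sub_mul, mul_smul_comm, mul_one, smul_mul_assoc]
        noncomm_ring
  have hT : (2 : ℝ) • ∑ A, ∑ B, ∑ C, ∑ D, r A B C D • (c A * c C * (p B * p D)) =
      ∑ A, ∑ B, ∑ C, ∑ D, r A B C D • (c B * c A * (p D * p C)) := by
    rw [two_smul]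
    conv_lhs => enter [2]; rw [sum_swap_outer]
    have hswap (A : ι) : ∑ B, ∑ C, ∑ D, r A B C D • (c B * c A * (p D * p C)) =
        ∑ C, ∑ B, ∑ D, r A B C D • (c B * c A * (p D * p C)) := Finset.sum_comm
    simp only [hswap, ← Finset.sum_add_distrib]
    refine Finset.sum_congr rfl fun A _ => Finset.sum_congr rfl fun B _ =>
      Finset.sum_congr rfl fun C _ => Finset.sum_congr rfl fun D _ => ?_
    rw [hc C A, hp D B, show r A C B D = r A B C D - r C B A D by
      linarith [h3 A B C D, h1 B C A D, h1 C A B D]]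
    simp only [neg_mul, mul_neg, neg_neg]
    module
  calc _ = ∑ A, ∑ B, ∑ C, ∑ D, r A B C D • (c A * c B * (c C * p D)) +
        (lam • ∑ A, ∑ B, ∑ C, ∑ D, r A B C D • (c A * p B * (c C * p D)) +
        lam • ∑ A, ∑ B, ∑ C, ∑ D, r A B C D • (p A * c B * (c C * p D))) +
        (lam * lam) • ∑ A, ∑ B, ∑ C, ∑ D, r A B C D • (p A * p B * (c C * p D)) := by
        simp only [Finset.mul_sum, Finset.smul_sum, ← Finset.sum_add_distrib]
        refine Finset.sum_congr rfl fun A _ => Finset.sum_congr rfl fun B _ =>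
          Finset.sum_congr rfl fun C _ => Finset.sum_congr rfl fun D _ => ?_
        simp only [add_mul, mul_add, smul_mul_assoc, mul_smul_comm]
        module
    _ = _ := by
        rw [hccc, hppp, hpc_cp, hcp, ← hT]
        module

end CurvatureIdentity

section CanonicalAnticommutation

variable {ι E : Type*} [Fintype ι] [DecidableEq ι] [Ring E] [Algebra ℝ E] {c i : ι → E}

/-- The action `Σ_{C,D} M^D{}_C c^C i_D` of a matrix in terms of creation operators `c` and
annihilation operators `i`. -/
def matrixAction (c i : ι → E) (M : Matrix ι ι ℝ) : E :=
  ∑ D, ∑ C, M D C • (c C * i D)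

/-- The annihilation operators `Σ_B γ^{AB} i_B` with index raised by `γ`. -/
def raiseIndex (i : ι → E) (γ : ι → ι → ℝ) (A : ι) : E :=
  ∑ B, γ A B • i B

omit [DecidableEq ι] in
theorem matrixAction_add (M N : Matrix ι ι ℝ) :
    matrixAction c i (M + N) = matrixAction c i M + matrixAction c i N := by
  simp only [matrixAction, Matrix.add_apply, add_smul, Finset.sum_add_distrib]

omit [DecidableEq ι] in
theorem matrixAction_sub (M N : Matrix ι ι ℝ) :
    matrixAction c i (M - N) = matrixAction c i M - matrixAction c i N := by
  simp only [matrixAction, Matrix.sub_apply, sub_smul, Finset.sum_sub_distrib]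

omit [DecidableEq ι] in
theorem raiseIndex_anticomm (hii : ∀ A B, i A * i B = -(i B * i A)) (γ : ι → ι → ℝ) (A B : ι) :
    raiseIndex i γ A * raiseIndex i γ B = -(raiseIndex i γ B * raiseIndex i γ A) := by
  simp only [raiseIndex, Finset.sum_mul, Finset.mul_sum, smul_mul_assoc, mul_smul_comm,
    Finset.smul_sum, ← Finset.sum_neg_distrib, ← smul_neg]
  rw [Finset.sum_comm]
  exact Finset.sum_congr rfl fun D _ => Finset.sum_congr rfl fun C _ => by
    rw [hii D C, smul_comm]

variable (hic : ∀ A B, i A * c B = (if A = B then 1 else 0) - c B * i A)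
include hic

theorem raiseIndex_mul (γ : ι → ι → ℝ) (A B : ι) :
    raiseIndex i γ A * c B = γ A B • 1 - c B * raiseIndex i γ A := by
  simp only [raiseIndex, Finset.sum_mul, Finset.mul_sum, smul_mul_assoc, mul_smul_comm, hic,
    smul_sub, Finset.sum_sub_distrib, smul_ite, smul_zero]
  simp

theorem matrixAction_mul_creation (hcc : ∀ A B, c A * c B = -(c B * c A)) (M : Matrix ι ι ℝ)
    (F : ι) : matrixAction c i M * c F = c F * matrixAction c i M + ∑ C, M F C • c C := by
  have h (C D : ι) : c C * i D * c F =
      c F * (c C * i D) + if D = F then c C else 0 := by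
    rw [mul_assoc, hic, mul_sub, ← mul_assoc, hcc C F]
    split_ifs <;> noncomm_ring
  simp only [matrixAction, Finset.sum_mul, Finset.mul_sum, smul_mul_assoc, mul_smul_comm, h,
    smul_add, Finset.sum_add_distrib, smul_ite, smul_zero]
  congr 1
  rw [Finset.sum_comm]
  simp

variable (hii : ∀ A B, i A * i B = -(i B * i A))
include hii

theorem matrixAction_mul_annihilation (M : Matrix ι ι ℝ) (F : ι) :
    matrixAction c i M * i F = i F * matrixAction c i M - ∑ D, M D F • i D := by
  have h (C D : ι) : c C * i D * i F =
      i F * (c C * i D) - if F = C then i D else 0 := by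
    rw [mul_assoc, hii D F, ← mul_assoc (i F), hic F C, sub_mul]
    split_ifs <;> noncomm_ring
  simp only [matrixAction, Finset.sum_mul, Finset.mul_sum, smul_mul_assoc, mul_smul_comm, h,
    smul_sub, Finset.sum_sub_distrib, smul_ite, smul_zero]
  simp

theorem matrixAction_mul_raiseIndex (γ : ι → ι → ℝ) (M : Matrix ι ι ℝ) (B : ι) :
    matrixAction c i M * raiseIndex i γ B =
      raiseIndex i γ B * matrixAction c i M - ∑ F, (∑ D, γ B D * M F D) • i F := by
  simp only [raiseIndex, Finset.sum_mul, Finset.mul_sum, smul_mul_assoc, mul_smul_comm,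
    matrixAction_mul_annihilation hic hii, smul_sub, Finset.sum_sub_distrib, Finset.smul_sum,
    smul_smul, Finset.sum_smul]
  congr 1
  exact Finset.sum_comm

theorem matrixAction_commutator (hcc : ∀ A B, c A * c B = -(c B * c A)) (M N : Matrix ι ι ℝ) :
    matrixAction c i M * matrixAction c i N - matrixAction c i N * matrixAction c i M =
      matrixAction c i (N * M - M * N) := by
  have h (C D : ι) : matrixAction c i M * (c C * i D) - c C * i D * matrixAction c i M =
      ∑ F, M C F • (c F * i D) - ∑ F, M F D • (c C * i F) := by
    rw [← mul_assoc, matrixAction_mul_creation hic hcc, add_mul, mul_assoc,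
      matrixAction_mul_annihilation hic hii]
    simp only [mul_sub, Finset.mul_sum, Finset.sum_mul, smul_mul_assoc, mul_smul_comm]
    noncomm_ring
  have hN (R : E) : R * matrixAction c i N - matrixAction c i N * R =
      ∑ D, ∑ C, N D C • (R * (c C * i D) - c C * i D * R) := by
    simp only [matrixAction, Finset.sum_mul, Finset.mul_sum, smul_mul_assoc, mul_smul_comm,
      smul_sub, Finset.sum_sub_distrib]
  rw [hN]
  simp only [h, smul_sub, Finset.sum_sub_distrib, matrixAction_sub, Finset.smul_sum, smul_smul]
  congr 1
  · simp only [matrixAction, Matrix.mul_apply, Finset.sum_smul]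
    exact Finset.sum_congr rfl fun D _ => Finset.sum_comm
  · simp only [matrixAction, Matrix.mul_apply, Finset.sum_smul]
    rw [sum_swap_outer]
    simp only [mul_comm]

end CanonicalAnticommutation

section Operators

variable {n : ℕ}

theorem Cop_mul_Cop (A B : Fin n) : Cop A * Cop B = -(Cop B * Cop A) := by
  refine LinearMap.ext fun x => ?_
  have h := ExteriorAlgebra.ι_add_mul_swap (R := ℝ) (Pi.single A (1 : ℝ) : Fin n → ℝ)
    (Pi.single B 1)
  simp only [Module.End.mul_apply, Cop, LinearMap.mulLeft_apply, LinearMap.neg_apply,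
    ← mul_assoc]
  rw [eq_neg_of_add_eq_zero_left h, neg_mul]

theorem iop_mul_iop (A B : Fin n) : iop A * iop B = -(iop B * iop A) := by
  refine LinearMap.ext fun x => ?_
  exact CliffordAlgebra.contractLeft_comm _ _ _

theorem iop_mul_Cop (A B : Fin n) :
    iop A * Cop B = (if A = B then 1 else 0) - Cop B * iop A := by
  refine LinearMap.ext fun x => ?_
  have h := CliffordAlgebra.contractLeft_ι_mul (Q := (0 : QuadraticForm ℝ (Fin n → ℝ)))
    (d := LinearMap.proj A) (Pi.single B 1) x
  refine h.trans ?_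
  by_cases hAB : A = B
  · subst hAB; simp [Cop, iop]
  · simp [Cop, iop, hAB]

end Operators

section WeakDerivative

variable {n : ℕ} {A : Fin n} {v u : (Fin n → ℝ) → Lam n} {v' u' : Lam n} {z : Fin n → ℝ}

/-- `v' = ∂_A v` at `z`, tested against linear functionals on `Λ`. -/
def HasWeakPD (A : Fin n) (v : (Fin n → ℝ) → Lam n) (v' : Lam n) (z : Fin n → ℝ) : Prop :=
  ∀ φ : Module.Dual ℝ (Lam n), DifferentiableAt ℝ (fun w => φ (v w)) z ∧
    φ v' = pd A (fun w => φ (v w)) z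

namespace HasWeakPD

theorem unique (hv : HasWeakPD A v v' z)
    (h : ∀ φ : Module.Dual ℝ (Lam n), φ u' = pd A (fun w => φ (v w)) z) : u' = v' :=
  (Module.forall_dual_apply_eq_zero_iff ℝ _).1 (fun φ => by
    rw [map_sub, h, (hv φ).2, sub_self]) |> sub_eq_zero.1

theorem add (hv : HasWeakPD A v v' z) (hu : HasWeakPD A u u' z) :
    HasWeakPD A (fun w => v w + u w) (v' + u') z := fun φ => by
  simp only [map_add]
  exact ⟨(hv φ).1.fun_add (hu φ).1, by rw [pd_add (hv φ).1 (hu φ).1, (hv φ).2, (hu φ).2]⟩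

theorem sub (hv : HasWeakPD A v v' z) (hu : HasWeakPD A u u' z) :
    HasWeakPD A (fun w => v w - u w) (v' - u') z := fun φ => by
  simp only [map_sub]
  exact ⟨(hv φ).1.fun_sub (hu φ).1, by rw [pd_sub (hv φ).1 (hu φ).1, (hv φ).2, (hu φ).2]⟩

theorem sum {ι : Type*} {s : Finset ι} {V : ι → (Fin n → ℝ) → Lam n} {V' : ι → Lam n}
    (hV : ∀ i ∈ s, HasWeakPD A (V i) (V' i) z) :
    HasWeakPD A (fun w => ∑ i ∈ s, V i w) (∑ i ∈ s, V' i) z := fun φ => by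
  simp only [map_sum]
  exact ⟨DifferentiableAt.fun_sum fun i hi => (hV i hi φ).1, by
    rw [pd_sum fun i hi => (hV i hi φ).1]
    exact Finset.sum_congr rfl fun i hi => (hV i hi φ).2⟩

theorem map (hv : HasWeakPD A v v' z) (T : Lam n →ₗ[ℝ] Lam n) :
    HasWeakPD A (fun w => T (v w)) (T v') z := fun φ => hv (φ ∘ₗ T)

theorem smul {f : (Fin n → ℝ) → ℝ} (hf : DifferentiableAt ℝ f z) (hv : HasWeakPD A v v' z) :
    HasWeakPD A (fun w => f w • v w) (pd A f z • v z + f z • v') z := fun φ => by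
  simp only [map_smul, map_add, smul_eq_mul]
  exact ⟨hf.fun_mul (hv φ).1, by rw [pd_mul hf (hv φ).1, (hv φ).2]⟩

theorem const_smul (c : ℝ) (hv : HasWeakPD A v v' z) :
    HasWeakPD A (fun w => c • v w) (c • v') z :=
  hv.map (c • LinearMap.id)

end HasWeakPD

theorem exists_hasWeakPD (A : Fin n)
    (hv : ∀ φ : Module.Dual ℝ (Lam n), DifferentiableAt ℝ (fun w => φ (v w)) z) :
    ∃ v', HasWeakPD A v v' z := by
  let b := (Pi.basisFun ℝ (Fin n)).ExteriorAlgebra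
  refine ⟨∑ i, pd A (fun w => b.coord i (v w)) z • b i, fun φ => ⟨hv φ, ?_⟩⟩
  have h : (fun w => φ (v w)) = fun w => ∑ i, b.coord i (v w) * φ (b i) := by
    ext w
    conv_lhs => rw [← b.sum_repr (v w), map_sum]
    simp only [map_smul, smul_eq_mul, Module.Basis.coord_apply]
  rw [h, pd_sum_mul (fun i => hv (b.coord i)) fun i => differentiableAt_const _]
  simp [pd_const]

end WeakDerivative

section PointwiseWeitzenbock

variable {ι V : Type*} [Fintype ι] [DecidableEq ι] [AddCommGroup V] [Module ℝ V]
  {c i : ι → Module.End ℝ V}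

/-- The Clifford generator `c^A + λ p^A`. -/
def cliffordGen {E : Type*} [Ring E] [Algebra ℝ E] (c i : ι → E) (γ : ι → ι → ℝ) (lam : ℝ)
    (A : ι) : E :=
  c A + lam • raiseIndex i γ A

theorem matrixAction_mul_cliffordGen {E : Type*} [Ring E] [Algebra ℝ E] {c i : ι → E}
    (hcc : ∀ A B, c A * c B = -(c B * c A)) (hii : ∀ A B, i A * i B = -(i B * i A))
    (hic : ∀ A B, i A * c B = (if A = B then 1 else 0) - c B * i A)
    {γ dγ : ι → ι → ℝ} {M : Matrix ι ι ℝ}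
    (hdγ : ∀ B D, dγ B D = -(∑ C, M B C * γ C D) - ∑ C, γ B C * M D C) (lam : ℝ) (B : ι) :
    matrixAction c i M * cliffordGen c i γ lam B =
      cliffordGen c i γ lam B * matrixAction c i M + ∑ C, M B C • cliffordGen c i γ lam C +
        lam • raiseIndex i dγ B := by
  have h : raiseIndex i dγ B = -(∑ C, M B C • raiseIndex i γ C) -
      ∑ F, (∑ D, γ B D * M F D) • i F := by
    simp only [raiseIndex, hdγ, sub_smul, neg_smul, Finset.sum_sub_distrib,
      Finset.sum_neg_distrib, Finset.sum_smul, Finset.smul_sum, smul_smul]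
    congr 2
    exact Finset.sum_comm
  rw [h]
  simp only [cliffordGen, mul_add, add_mul, mul_smul_comm, smul_mul_assoc,
    matrixAction_mul_creation hic hcc, matrixAction_mul_raiseIndex hic hii, smul_add,
    Finset.sum_add_distrib, smul_comm _ lam, ← Finset.smul_sum]
  module

theorem cliffordGen_mul_add_swap {E : Type*} [Ring E] [Algebra ℝ E] {c i : ι → E}
    (hcc : ∀ A B, c A * c B = -(c B * c A)) (hii : ∀ A B, i A * i B = -(i B * i A))
    (hic : ∀ A B, i A * c B = (if A = B then 1 else 0) - c B * i A)
    {γ : ι → ι → ℝ} (hγ : ∀ A B, γ A B = γ B A) (lam : ℝ) (A B : ι) :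
    cliffordGen c i γ lam A * cliffordGen c i γ lam B +
      cliffordGen c i γ lam B * cliffordGen c i γ lam A = (2 * lam * γ A B) • 1 := by
  simp only [cliffordGen, mul_add, add_mul, mul_smul_comm, smul_mul_assoc,
    raiseIndex_mul hic, hγ B A]
  rw [hcc A B, raiseIndex_anticomm hii γ A B]
  module

/-- The Weitzenböck formula at a point, in terms of the jets `η`, `η₁`, `η₂` of the form, the
connection matrices `Γ` with derivatives `dΓ`, and the metric `γ` with derivatives `dγ`. -/
theorem weitzenbock_pointwise
    (hcc : ∀ A B, c A * c B = -(c B * c A)) (hii : ∀ A B, i A * i B = -(i B * i A))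
    (hic : ∀ A B, i A * c B = (if A = B then 1 else 0) - c B * i A)
    {γ : ι → ι → ℝ} (hγ : ∀ A B, γ A B = γ B A) {dγ : ι → ι → ι → ℝ}
    {Γ : ι → Matrix ι ι ℝ} (hΓ : ∀ A B C, Γ A B C = Γ C B A)
    (hdγ : ∀ A B D, dγ A B D = -(∑ C, Γ A B C * γ C D) - ∑ C, γ B C * Γ A D C)
    {dΓ : ι → ι → Matrix ι ι ℝ} {r : ι → ι → ι → ι → ℝ}
    (hR : ∀ A B, dΓ A B - dΓ B A + (Γ A * Γ B - Γ B * Γ A) =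
      Matrix.of fun D C => ∑ F, γ D F * r A B C F)
    (h1 : ∀ A B C D, r A B C D = -r B A C D) (h2 : ∀ A B C D, r A B C D = -r A B D C)
    (h3 : ∀ A B C D, r A B C D + r B C A D + r C A B D = 0) (lam : ℝ)
    {η : V} {η₁ : ι → V} {η₂ : ι → ι → V} (hη₂ : ∀ A B, η₂ A B = η₂ B A)
    {N : ι → V} (hN : ∀ B, N B = η₁ B - matrixAction c i (Γ B) η) {dN : ι → ι → V}
    (hdN : ∀ A B, dN A B =
      η₂ A B - (matrixAction c i (dΓ A B) η + matrixAction c i (Γ B) (η₁ A))) :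
    ∑ A, cliffordGen c i γ lam A
        (∑ B, (cliffordGen c i γ lam B (dN A B) + lam • raiseIndex i (dγ A) B (N B)) -
          matrixAction c i (Γ A) (∑ B, cliffordGen c i γ lam B (N B))) -
      lam • ∑ A, ∑ B, (((∑ C, Γ A C C) * γ A B + dγ A A B) • N B + γ A B • dN A B -
        γ A B • matrixAction c i (Γ A) (N B)) =
      -lam • (∑ A, ∑ B, (∑ C, ∑ D, γ C D * r C A B D) • c A (raiseIndex i γ B η)) +
        (lam / 2) • ∑ A, ∑ B, ∑ C, ∑ D,
          r A B C D • c B (c A (raiseIndex i γ D (raiseIndex i γ C η))) := by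
  set Q := cliffordGen c i γ lam with hQ
  set K : ι → ι → V := fun A B =>
    dN A B - matrixAction c i (Γ A) (N B) - ∑ C, Γ A C B • N C with hK
  have hdirac (A : ι) : ∑ B, (Q B (dN A B) + lam • raiseIndex i (dγ A) B (N B)) -
      matrixAction c i (Γ A) (∑ B, Q B (N B)) = ∑ B, Q B (K A B) := by
    have hop (B : ι) : matrixAction c i (Γ A) (Q B (N B)) = Q B (matrixAction c i (Γ A) (N B)) +
        ∑ C, Γ A B C • Q C (N B) + lam • raiseIndex i (dγ A) B (N B) := by
      have h := congr_arg (fun T : Module.End ℝ V => T (N B))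
        (matrixAction_mul_cliffordGen hcc hii hic (hdγ A) lam B)
      simpa [LinearMap.sum_apply] using h
    simp only [map_sum, hop, hK, map_sub, map_smul, Finset.sum_add_distrib,
      Finset.sum_sub_distrib]
    rw [Finset.sum_comm (f := fun B C => Γ A B C • Q C (N B))]
    abel
  have hlap : ∑ A, ∑ B, (((∑ C, Γ A C C) * γ A B + dγ A A B) • N B + γ A B • dN A B -
        γ A B • matrixAction c i (Γ A) (N B)) = ∑ A, ∑ B, γ A B • K A B := by
    have hdiv (B : ι) : ∑ A, ((∑ C, Γ A C C) * γ A B + dγ A A B) =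
        -∑ A, ∑ C, γ A C * Γ A B C := by
      have h : ∑ A, ∑ C, Γ A A C * γ C B = ∑ A, ∑ C, Γ A C C * γ A B := by
        rw [Finset.sum_comm]
        exact Finset.sum_congr rfl fun A _ => Finset.sum_congr rfl fun C _ => by rw [hΓ]
      simp only [hdγ, Finset.sum_add_distrib, Finset.sum_sub_distrib, Finset.sum_neg_distrib, h,
        Finset.sum_mul]
      ring
    have hN' : ∑ A, ∑ B, ((∑ C, Γ A C C) * γ A B + dγ A A B) • N B =
        -∑ A, ∑ B, γ A B • ∑ C, Γ A C B • N C := by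
      rw [Finset.sum_comm]
      simp only [← Finset.sum_smul, hdiv, neg_smul, Finset.sum_neg_distrib, Finset.smul_sum,
        smul_smul]
      simp only [Finset.sum_smul]
      exact congr_arg Neg.neg (sum_rotate fun A B C => (γ A B * Γ A C B) • N C).symm
    simp only [hK, smul_sub, Finset.sum_add_distrib, Finset.sum_sub_distrib, hN']
    abel
  have hKK (A B : ι) : K A B - K B A =
      -(∑ C, ∑ D, r A B C D • (c C * raiseIndex i γ D)) η := by
    have hcurv : ∑ C, ∑ D, r A B C D • (c C * raiseIndex i γ D) = matrixAction c i (dΓ A B) -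
        matrixAction c i (dΓ B A) + (matrixAction c i (Γ B) * matrixAction c i (Γ A) -
          matrixAction c i (Γ A) * matrixAction c i (Γ B)) := by
      rw [matrixAction_commutator hic hii hcc, ← matrixAction_sub, ← matrixAction_add, hR]
      simp only [matrixAction, raiseIndex, Finset.mul_sum, Finset.smul_sum, mul_smul_comm,
        smul_smul, Matrix.of_apply, Finset.sum_smul]
      rw [sum_rotate]
      exact Finset.sum_congr rfl fun D _ => Finset.sum_congr rfl fun C _ =>
        Finset.sum_congr rfl fun F _ => by rw [hγ F D, mul_comm]
    have hsymm : ∑ C, Γ A C B • N C = ∑ C, Γ B C A • N C :=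
      Finset.sum_congr rfl fun C _ => by rw [hΓ]
    have h : K A B - K B A = (dN A B - matrixAction c i (Γ A) (N B)) -
        (dN B A - matrixAction c i (Γ B) (N A)) := by
      simp only [hK, hsymm]
      abel
    rw [h, hcurv]
    simp only [hdN, hN, hη₂ B A, LinearMap.add_apply, LinearMap.sub_apply,
      Module.End.mul_apply, map_sub]
    abel
  have hsym : (2 : ℝ) • (∑ A, ∑ B, Q A (Q B (K A B)) - lam • ∑ A, ∑ B, γ A B • K A B) =
      ∑ A, ∑ B, Q A (Q B (K A B - K B A)) := by
    have hswap (A B : ι) : Q A (Q B (K B A)) =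
        (2 * lam * γ A B) • K B A - Q B (Q A (K B A)) := by
      have h := congr_arg (fun T : Module.End ℝ V => T (K B A))
        (cliffordGen_mul_add_swap hcc hii hic hγ lam A B)
      exact eq_sub_of_add_eq h
    have hKs : ∑ A, ∑ B, γ A B • K B A = ∑ A, ∑ B, γ A B • K A B := by
      rw [Finset.sum_comm]
      exact Finset.sum_congr rfl fun A _ => Finset.sum_congr rfl fun B _ => by rw [hγ]
    simp only [map_sub, hswap, Finset.sum_sub_distrib, mul_smul, ← Finset.smul_sum, hKs]
    rw [Finset.sum_comm (f := fun A B => Q B (Q A (K B A)))]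
    module
  have hid := congr_arg (fun T : Module.End ℝ V => T η)
    (clifford_curvature_identity hcc (raiseIndex_anticomm hii γ)
    (raiseIndex_mul hic γ) hγ h1 h2 h3 lam)
  have hQQ : ∑ A, ∑ B, Q A (Q B (K A B - K B A)) = -(((2 * lam) •
      (∑ A, ∑ B, (∑ C, ∑ D, γ C D * r C A B D) • c A (raiseIndex i γ B η)) -
        lam • ∑ A, ∑ B, ∑ C, ∑ D,
          r A B C D • c B (c A (raiseIndex i γ D (raiseIndex i γ C η))))) := by
    simp only [LinearMap.sum_apply, Module.End.mul_apply, LinearMap.sub_apply,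
      LinearMap.smul_apply] at hid
    rw [← hid]
    simp only [hKK, map_neg, Finset.sum_neg_distrib, LinearMap.sum_apply, LinearMap.smul_apply,
      Module.End.mul_apply]
    rfl
  rw [Finset.sum_congr rfl fun A _ => congr_arg (Q A) (hdirac A), hlap]
  simp only [map_sum]
  have hdouble := hsym.trans hQQ
  have hhalf := congr_arg ((1 / 2 : ℝ) • ·) hdouble
  simp only [smul_smul] at hhalf
  norm_num at hhalf
  rw [hhalf]
  module

end PointwiseWeitzenbock

section Assembly

variable {n : ℕ} {U : Set (Fin n → ℝ)} {g gl : (Fin n → ℝ) → Fin n → Fin n → ℝ}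
  {z : Fin n → ℝ}

theorem matrixAction_Cop_iop_apply (M : Matrix (Fin n) (Fin n) ℝ) (x : Lam n) :
    matrixAction (E := Module.End ℝ (Lam n)) Cop iop M x =
      ∑ B, ∑ C, M B C • Cop C (iop B x) := by
  simp only [matrixAction, LinearMap.sum_apply]
  rfl

theorem raiseIndex_iop_apply (γ : Fin n → Fin n → ℝ) (A : Fin n) (x : Lam n) :
    raiseIndex (E := Module.End ℝ (Lam n)) iop γ A x = ∑ B, γ A B • iop B x := by
  simp only [raiseIndex, LinearMap.sum_apply]
  rfl

theorem cliffordGen_Cop_iop_apply (lam : ℝ) (A : Fin n) (x : Lam n) :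
    cliffordGen (E := Module.End ℝ (Lam n)) Cop iop (g z) lam A x =
      Cop A x + lam • Pop g A z x :=
  rfl

theorem HasWeakPD.nablaForm (H : IsMetricOn U g gl) (hz : z ∈ U) {η : (Fin n → ℝ) → Lam n}
    {dη : Fin n → (Fin n → ℝ) → Lam n} {A B : Fin n} {d2 : Lam n}
    (hd2 : HasWeakPD A (dη B) d2 z) (hη : HasWeakPD A η (dη A z) z) :
    HasWeakPD A (nablaForm g gl dη η B)
      (d2 - (matrixAction (E := Module.End ℝ (Lam n)) Cop iop
          (Matrix.of fun D C => pd A (christ g gl D B C) z) (η z) +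
        matrixAction (E := Module.End ℝ (Lam n)) Cop iop (christMatrix g gl B z) (dη A z))) z := by
  rw [matrixAction_Cop_iop_apply, matrixAction_Cop_iop_apply]
  simp only [← Finset.sum_add_distrib]
  exact hd2.sub (.sum fun D _ => .sum fun C _ =>
    .smul (H.differentiableAt_christ hz D B C) (hη.map (Cop C ∘ₗ iop D)))

theorem HasWeakPD.diracForm (H : IsMetricOn U g gl) (hz : z ∈ U) (lam : ℝ)
    {η : (Fin n → ℝ) → Lam n} {dη : Fin n → (Fin n → ℝ) → Lam n} {A : Fin n} {dN : Fin n → Lam n}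
    (hN : ∀ B, HasWeakPD A (_root_.nablaForm g gl dη η B) (dN B) z) :
    HasWeakPD A (diracForm g gl lam dη η)
      (∑ B, (cliffordGen (E := Module.End ℝ (Lam n)) Cop iop (g z) lam B (dN B) +
        lam • raiseIndex (E := Module.End ℝ (Lam n)) iop (fun B D => pd A (fun w => g w B D) z) B
          (_root_.nablaForm g gl dη η B z))) z := by
  have h (B : Fin n) : HasWeakPD A (fun w => Pop g B w (_root_.nablaForm g gl dη η B w))
      (∑ D, (pd A (fun w => g w B D) z • iop D (_root_.nablaForm g gl dη η B z) +
        g z B D • iop D (dN B))) z := by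
    simp only [Pop, LinearMap.sum_apply, LinearMap.smul_apply]
    exact .sum fun D _ => .smul (H.differentiableAt_g hz B D) ((hN B).map (iop D))
  refine .sum fun B _ => ?_
  convert ((hN B).map (Cop B)).add ((h B).const_smul lam) using 1
  rw [cliffordGen_Cop_iop_apply, raiseIndex_iop_apply, Finset.sum_add_distrib]
  simp only [Pop, LinearMap.sum_apply, LinearMap.smul_apply]
  module

theorem HasWeakPD.innerLap (H : IsMetricOn U g gl) (hz : z ∈ U) {η : (Fin n → ℝ) → Lam n}
    {dη : Fin n → (Fin n → ℝ) → Lam n} {A B : Fin n} {dN : Lam n}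
    (hN : HasWeakPD A (_root_.nablaForm g gl dη η B) dN z) :
    HasWeakPD A (innerLap g gl dη η A B)
      (rhoG gl z • (((∑ C, christ g gl C A C z) * g z A B + pd A (fun w => g w A B) z) •
        _root_.nablaForm g gl dη η B z + g z A B • dN)) z := by
  obtain ⟨hρ, -, hpd⟩ := H.pd_rhoG hz A
  have hg := H.differentiableAt_g hz A B
  have h := HasWeakPD.smul (hρ.fun_mul hg) hN
  rw [pd_mul hρ hg, hpd] at h
  have he : rhoG gl z • (((∑ C, christ g gl C A C z) * g z A B + pd A (fun w => g w A B) z) •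
      _root_.nablaForm g gl dη η B z + g z A B • dN) =
      (rhoG gl z * (∑ C, christ g gl C A C z) * g z A B +
        rhoG gl z * pd A (fun w => g w A B) z) • _root_.nablaForm g gl dη η B z +
      (rhoG gl z * g z A B) • dN := by
    module
  rw [he]
  exact h

theorem exists_second_weakPD (hU : IsOpen U) (hz : z ∈ U) {η : (Fin n → ℝ) → Lam n}
    {dη : Fin n → (Fin n → ℝ) → Lam n}
    (hη : ∀ φ : Module.Dual ℝ (Lam n), ContDiffOn ℝ (⊤ : ℕ∞) (fun w => φ (η w)) U)
    (hdη : ∀ (φ : Module.Dual ℝ (Lam n)) (A : Fin n), ∀ z ∈ U,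
      φ (dη A z) = pd A (fun w => φ (η w)) z) :
    ∃ d2 : Fin n → Fin n → Lam n, (∀ A B, HasWeakPD A (dη B) (d2 A B) z) ∧
      ∀ A B, d2 A B = d2 B A := by
  have hev (φ : Module.Dual ℝ (Lam n)) (B : Fin n) :
      (fun w => φ (dη B w)) =ᶠ[𝓝 z] pd B fun w => φ (η w) :=
    Filter.mem_of_superset (hU.mem_nhds hz) (hdη φ B)
  have hex (A B : Fin n) : ∃ v, HasWeakPD A (dη B) v z := exists_hasWeakPD A fun φ =>
    (((hη φ).pd hU B).differentiableAt_of_isOpen hU hz).congr_of_eventuallyEq (hev φ B)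
  choose d2 hd2 using hex
  refine ⟨d2, hd2, fun A B => (hd2 A B).unique (u' := d2 B A) (fun φ => ?_) |>.symm⟩
  rw [(hd2 B A φ).2, pd_congr (hev φ A), pd_congr (hev φ B), pd_comm hU (hη φ) hz]

theorem IsMetricOn.ricci_eq (H : IsMetricOn U g gl) (hz : z ∈ U) (A B : Fin n) :
    ricci g gl A B z = ∑ C, ∑ D, g z C D * riemLow g gl C A B D z :=
  Finset.sum_congr rfl fun _ _ => H.riem_eq_sum_riemLow hz _ _ _ _

end Assembly

/-- Weitzenböck formula for exterior forms:
`D(Dη) − λ·Δ^{(T)}η = −λ·Σ_{A,B} R_{AB}·C^A(P^B η)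
  + (λ/2)·Σ_{A,B,C,D} R_{AB,CD}·C^B(C^A(P^D(P^C η)))`,
where `Dη := Σ_A (C^A + λP^A)(∇_A η)` and
`Δ^{(T)}η := (1/ρ_g)·Σ_{A,B} ∇_A(ρ_g·g^{AB}·∇_B η)`.
Partial derivatives of the `Λ`-valued functions `η`, `Dη` and `ρ_g·g^{AB}·∇_Bη` are encoded
weakly, through arbitrary linear functionals `φ` on `Λ`. -/
theorem stmt13 {n : ℕ} (U : Set (Fin n → ℝ)) (hU : IsOpen U)
    (g gl : (Fin n → ℝ) → Fin n → Fin n → ℝ)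
    (hg : ∀ A B, ContDiffOn ℝ (⊤ : ℕ∞) (fun z => g z A B) U)
    (hgsymm : ∀ z ∈ U, ∀ A B, g z A B = g z B A)
    (hginv : ∀ z ∈ U, ∀ A C, ∑ B, gl z A B * g z B C = if A = C then 1 else 0)
    (hgpos : ∀ z ∈ U, (Matrix.of fun A B => gl z A B).PosDef)
    (lam : ℝ)
    -- the smooth exterior form `η`, with partial derivatives `dη A = ∂_A η`
    (η : (Fin n → ℝ) → Lam n) (dη : Fin n → (Fin n → ℝ) → Lam n)
    (hηsmooth : ∀ φ : Module.Dual ℝ (Lam n), ContDiffOn ℝ (⊤ : ℕ∞) (fun w => φ (η w)) U)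
    (hdη : ∀ (φ : Module.Dual ℝ (Lam n)) (A : Fin n), ∀ z ∈ U,
      φ (dη A z) = pd A (fun w => φ (η w)) z)
    -- `dDη A = ∂_A (Dη)`
    (dDη : Fin n → (Fin n → ℝ) → Lam n)
    (hdDη : ∀ (φ : Module.Dual ℝ (Lam n)) (A : Fin n), ∀ z ∈ U,
      φ (dDη A z) = pd A (fun w => φ (diracForm g gl lam dη η w)) z)
    -- `dK A B = ∂_A (ρ_g·g^{AB}·∇_B η)`
    (dK : Fin n → Fin n → (Fin n → ℝ) → Lam n)
    (hdK : ∀ (φ : Module.Dual ℝ (Lam n)) (A B : Fin n), ∀ z ∈ U,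
      φ (dK A B z) = pd A (fun w => φ (innerLap g gl dη η A B w)) z) :
    ∀ z ∈ U,
      (∑ A, (Cop A (dDη A z - ∑ B, ∑ C, christ g gl B A C z •
              Cop C (iop B (diracForm g gl lam dη η z)))
          + lam • Pop g A z (dDη A z - ∑ B, ∑ C, christ g gl B A C z •
              Cop C (iop B (diracForm g gl lam dη η z)))))
        - lam • ((rhoG gl z)⁻¹ • ∑ A, ∑ B,
            (dK A B z - ∑ C, ∑ D, christ g gl C A D z •
              Cop D (iop C (innerLap g gl dη η A B z))))
      = -lam • (∑ A, ∑ B, ricci g gl A B z • Cop A (Pop g B z (η z)))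
        + (lam / 2) • (∑ A, ∑ B, ∑ C, ∑ D, riemLow g gl A B C D z •
            Cop B (Cop A (Pop g D z (Pop g C z (η z))))) := by
  intro z hz
  have H : IsMetricOn U g gl := ⟨hU, hg, hgsymm, hginv, hgpos⟩
  obtain ⟨d2, hd2, hd2symm⟩ := exists_second_weakPD hU hz hηsmooth hdη
  have hη (A : Fin n) : HasWeakPD A η (dη A z) z := fun φ =>
    ⟨(hηsmooth φ).differentiableAt_of_isOpen hU hz, hdη φ A z hz⟩
  have hN (A B : Fin n) := HasWeakPD.nablaForm H hz (hd2 A B) (hη A)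
  have hD (A : Fin n) := (HasWeakPD.diracForm H hz lam (hN A)).unique fun φ => hdDη φ A z hz
  have hK (A B : Fin n) := (HasWeakPD.innerLap H hz (hN A B)).unique fun φ => hdK φ A B z hz
  have key := weitzenbock_pointwise (c := (Cop : Fin n → Module.End ℝ (Lam n))) (i := iop)
    Cop_mul_Cop iop_mul_iop iop_mul_Cop (γ := g z) (hgsymm z hz)
    (dγ := fun A B D => pd A (fun w => g w B D) z) (Γ := fun A => christMatrix g gl A z)
    (fun A B C => H.christ_symm hz B A C) (fun A B D => H.pd_g hz A B D)
    (dΓ := fun A B => Matrix.of fun D C => pd A (christ g gl D B C) z)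
    (r := fun A B C D => riemLow g gl A B C D z)
    (fun A B => by
      rw [← riemMatrix_eq]
      ext D C
      exact H.riem_eq_sum_riemLow hz A B C D)
    (fun A B C D => riemLow_antisymm A B C D) (H.riemLow_skew hz) (H.riemLow_bianchi hz) lam
    (η := η z) (η₁ := fun B => dη B z) hd2symm (N := fun B => nablaForm g gl dη η B z)
    (fun B => by rw [matrixAction_Cop_iop_apply]; rfl) (fun A B => rfl)
  have hρ (A : Fin n) := (H.pd_rhoG hz A).2.1.ne'
  simp only [H.ricci_eq hz]
  refine Eq.trans ?_ key
  have hLap (A B : Fin n) : dK A B z - ∑ C, ∑ D, christ g gl C A D z •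
      Cop D (iop C (innerLap g gl dη η A B z)) =
      rhoG gl z • (((∑ C, christ g gl C A C z) * g z A B + pd A (fun w => g w A B) z) •
        nablaForm g gl dη η B z + g z A B • (d2 A B -
          (matrixAction (E := Module.End ℝ (Lam n)) Cop iop
            (Matrix.of fun D C => pd A (christ g gl D B C) z) (η z) +
          matrixAction (E := Module.End ℝ (Lam n)) Cop iop (christMatrix g gl B z) (dη A z))) -
        g z A B • matrixAction (E := Module.End ℝ (Lam n)) Cop iop (christMatrix g gl A z)
          (nablaForm g gl dη η B z)) := by
    have h : ∑ C, ∑ D, christ g gl C A D z • Cop D (iop C (innerLap g gl dη η A B z)) =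
        rhoG gl z • g z A B • matrixAction (E := Module.End ℝ (Lam n)) Cop iop
          (christMatrix g gl A z) (nablaForm g gl dη η B z) := by
      rw [smul_smul, ← map_smul, matrixAction_Cop_iop_apply]
      rfl
    rw [hK, h, ← smul_sub]
  have hDir (A : Fin n) : ∑ B, ∑ C, christ g gl B A C z •
      Cop C (iop B (diracForm g gl lam dη η z)) = matrixAction (E := Module.End ℝ (Lam n)) Cop iop
        (christMatrix g gl A z) (diracForm g gl lam dη η z) :=
    (matrixAction_Cop_iop_apply _ _).symm
  have hcancel (v : Fin n → Fin n → Lam n) :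
      (rhoG gl z)⁻¹ • ∑ A, ∑ B, rhoG gl z • v A B = ∑ A, ∑ B, v A B := by
    simp only [Finset.smul_sum]
    exact Finset.sum_congr rfl fun A _ => Finset.sum_congr rfl fun B _ =>
      inv_smul_smul₀ (hρ A) _
  simp only [hLap, hDir, hcancel, hD]
  rfl
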